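/- Let c₁, c₂, c₃, c₄ > 0 be real constants. Suppose x₁, x₂ : ℝ → ℝ are differentiable and satisfy x₁'(t) = x₂(t) and x₂'(t) = −c₁·x₁(t) − c₂·tanh(x₁(t)) − c₃·x₂(t) − c₄·tanh(x₂(t)) for all t. Define V(p, q) = (c₁/2)·p² + c₂·log(cosh p) + q²/2. Then for every t, the function t ↦ V(x₁(t), x₂(t)) is differentiable at t with derivative equal to −x₂(t)·(c₃·x₂(t) + c₄·tanh(x₂(t))), and this derivative is at most −c₃·x₂(t)². -/

import Mathlib

/-- Verification of the Lyapunov function for the second half of the training dataset: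
for the system `ẋ₁ = x₂`, `ẋ₂ = −c₁x₁ − c₂ tanh x₁ − c₃x₂ − c₄ tanh x₂`, the function
`V(p,q) = (c₁/2)p² + c₂ log (cosh p) + q²/2` satisfies
`V̇ = −x₂ (c₃ x₂ + c₄ tanh x₂) ≤ −c₃ x₂²` along solutions. -/
theorem tanh_system_lyapunov_derivative
    (c₁ c₂ c₃ c₄ : ℝ) (hc₁ : 0 < c₁) (hc₂ : 0 < c₂) (hc₃ : 0 < c₃) (hc₄ : 0 < c₄)
    (x₁ x₂ : ℝ → ℝ)
    (hx₁ : ∀ t : ℝ, HasDerivAt x₁ (x₂ t) t)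
    (hx₂ : ∀ t : ℝ, HasDerivAt x₂
      (-c₁ * x₁ t - c₂ * Real.tanh (x₁ t) - c₃ * x₂ t - c₄ * Real.tanh (x₂ t)) t)
    (V : ℝ × ℝ → ℝ)
    (hV : ∀ p q : ℝ, V (p, q) = c₁ / 2 * p ^ 2 + c₂ * Real.log (Real.cosh p) + q ^ 2 / 2) :
    ∀ t : ℝ,
      HasDerivAt (fun s => V (x₁ s, x₂ s))
          (-(x₂ t * (c₃ * x₂ t + c₄ * Real.tanh (x₂ t)))) t ∧
        -(x₂ t * (c₃ * x₂ t + c₄ * Real.tanh (x₂ t))) ≤ -c₃ * x₂ t ^ 2 := by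
  intro t
  have hcosh : Real.cosh (x₁ t) ≠ 0 := (Real.cosh_pos _).ne'
  constructor
  · have h := ((((hx₁ t).pow 2).const_mul (c₁ / 2)).add
      (((hx₁ t).cosh.log hcosh).const_mul c₂)).add (((hx₂ t).pow 2).div_const 2)
    have hfun : (fun s => V (x₁ s, x₂ s)) = fun s =>
        c₁ / 2 * x₁ s ^ 2 + c₂ * Real.log (Real.cosh (x₁ s)) + x₂ s ^ 2 / 2 := by
      funext s
      exact hV _ _
    rw [hfun]
    refine h.congr_deriv ?_
    rw [Real.tanh_eq_sinh_div_cosh (x₁ t)]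
    push_cast
    field_simp
    ring
  · have hy : 0 ≤ x₂ t * Real.tanh (x₂ t) := by
      rw [Real.tanh_eq_sinh_div_cosh, ← mul_div_assoc]
      refine div_nonneg ?_ (Real.cosh_pos _).le
      rcases le_total 0 (x₂ t) with h | h
      · exact mul_nonneg h (Real.sinh_nonneg_iff.2 h)
      · exact mul_nonneg_of_nonpos_of_nonpos h (Real.sinh_nonpos_iff.2 h)
    nlinarith [mul_nonneg hc₄.le hy]
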